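/- Let X be a set, n ≥ 1 a natural number, z : Fin n → X → ℝ a family of objective functions, ε : Fin n → ℝ a vector of lower bounds, and λ : Fin n → ℝ with λ(i) > 0 for every i ≠ 0. Let S = {x ∈ X : z(i)(x) ≥ ε(i) for all i ≠ 0}. Suppose x* ∈ S maximises the augmented objective over S, i.e. for all x ∈ S, z(0)(x) + ∑_{i ≠ 0} λ(i)·z(i)(x) ≤ z(0)(x*) + ∑_{i ≠ 0} λ(i)·z(i)(x*). Then x* is non-dominated in X: there is no y ∈ X such that z(i)(y) ≥ z(i)(x*) for all i and z(i)(y) > z(i)(x*) for at least one i. -/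

import Mathlib

/-- Every optimal solution of the augmented ε-constraint problem is
non-dominated (Pareto optimal). -/
theorem augmented_eps_constraint_nondominated (X : Type) (n : ℕ) (hn : 1 ≤ n)
    (z : Fin n → X → ℝ) (ε lam : Fin n → ℝ)
    (hlam : ∀ i : Fin n, i ≠ ⟨0, hn⟩ → 0 < lam i)
    (xs : X)
    (hxsS : ∀ i : Fin n, i ≠ ⟨0, hn⟩ → ε i ≤ z i xs)
    (hmax : ∀ x : X, (∀ i : Fin n, i ≠ ⟨0, hn⟩ → ε i ≤ z i x) →
      z ⟨0, hn⟩ x + ∑ i ∈ Finset.univ.filter (fun i => i ≠ (⟨0, hn⟩ : Fin n)), lam i * z i x ≤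
      z ⟨0, hn⟩ xs + ∑ i ∈ Finset.univ.filter (fun i => i ≠ (⟨0, hn⟩ : Fin n)), lam i * z i xs) :
    ¬ ∃ y : X, (∀ i : Fin n, z i xs ≤ z i y) ∧ ∃ i : Fin n, z i xs < z i y := by
  rintro ⟨y, hle, j, hj⟩
  have hy := hmax y fun i hi => (hxsS i hi).trans (hle i)
  have hterm : ∀ i ∈ Finset.univ.filter (fun i => i ≠ (⟨0, hn⟩ : Fin n)),
      lam i * z i xs ≤ lam i * z i y := fun i hi =>
    mul_le_mul_of_nonneg_left (hle i) (hlam i (Finset.mem_filter.mp hi).2).le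
  by_cases h : j = ⟨0, hn⟩
  · subst h
    linarith [Finset.sum_le_sum hterm]
  · have hlt := Finset.sum_lt_sum hterm
      ⟨j, Finset.mem_filter.mpr ⟨Finset.mem_univ j, h⟩, mul_lt_mul_of_pos_left hj (hlam j h)⟩
    linarith [hle ⟨0, hn⟩]
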